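/- arXiv:1303.1910 — 5 statements merged into one kernel-verified Lean document; each statement's English description precedes it below -/
import Mathlib

section
/- Let C be an 𝔽₂-linear subspace (a linear code) of the space of functions from a 40-element index set to ℤ/2ℤ. If the dimension of C over 𝔽₂ is at least 7, then C contains a nonzero element whose Hamming weight (number of nonzero coordinates) is strictly less than 20. -/
def gries : ℕ → ℕ → ℕ
  | 0, _ => 0
  | k + 1, d => d + gries k ((d + 1) / 2)

lemma gries_mono (k : ℕ) : ∀ d e : ℕ, d ≤ e → gries k d ≤ gries k e := by
  induction k with
  | zero => intro d e _; simp [gries]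
  | succ k ih =>
    intro d e h
    have := ih ((d + 1) / 2) ((e + 1) / 2) (by omega)
    simp only [gries]
    omega

def wtOn (S : Finset (Fin 40)) (x : Fin 40 → ZMod 2) : ℕ :=
  ∑ i ∈ S, if x i = 0 then 0 else 1

lemma wtOn_residual (S : Finset (Fin 40)) (x c : Fin 40 → ZMod 2) :
    wtOn S x + wtOn S (x + c) = 2 * wtOn (S.filter (fun i => c i = 0)) x + wtOn S c := by
  unfold wtOn
  rw [Finset.sum_filter, Finset.mul_sum, ← Finset.sum_add_distrib, ← Finset.sum_add_distrib]
  apply Finset.sum_congr rfl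
  intro i _
  have key : ∀ a b : ZMod 2, ((if a = 0 then 0 else 1) + if a + b = 0 then 0 else 1) =
      (2 * if b = 0 then if a = 0 then 0 else 1 else 0) + if b = 0 then 0 else 1 := by
    decide
  exact key (x i) (c i)

lemma card_residual (S : Finset (Fin 40)) (c : Fin 40 → ZMod 2) :
    S.card = wtOn S c + (S.filter (fun i => c i = 0)).card := by
  unfold wtOn
  rw [Finset.card_eq_sum_ones, Finset.card_eq_sum_ones, Finset.sum_filter,
    ← Finset.sum_add_distrib]
  apply Finset.sum_congr rfl
  intro i _
  split_ifs <;> rfl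

lemma finrank_hyper (C : Submodule (ZMod 2) (Fin 40 → ZMod 2)) (i : Fin 40) :
    Module.finrank (ZMod 2) C ≤ Module.finrank (ZMod 2)
      (C ⊓ LinearMap.ker (LinearMap.proj (R := ZMod 2) (φ := fun _ : Fin 40 => ZMod 2) i) :
        Submodule (ZMod 2) (Fin 40 → ZMod 2)) + 1 := by
  set f := LinearMap.proj (R := ZMod 2) (φ := fun _ : Fin 40 => ZMod 2) i
  have h1 := Submodule.finrank_sup_add_finrank_inf_eq C (LinearMap.ker f)
  have h2 := LinearMap.finrank_range_add_finrank_ker f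
  have h3 := Submodule.finrank_le (LinearMap.range f)
  have h4 := Submodule.finrank_le (C ⊔ LinearMap.ker f)
  rw [Module.finrank_self] at h3
  omega

lemma griesmer (k : ℕ) : ∀ (d : ℕ) (S : Finset (Fin 40))
    (C : Submodule (ZMod 2) (Fin 40 → ZMod 2)), k ≤ Module.finrank (ZMod 2) C →
    (∀ x ∈ C, x ≠ 0 → d ≤ wtOn S x) → gries k d ≤ S.card := by
  induction k with
  | zero => intro d S C _ _; simp [gries]
  | succ k ih =>
    intro d S C hk hd
    have hne : ∃ x, x ∈ C ∧ x ≠ 0 := by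
      apply (Submodule.ne_bot_iff C).mp
      rintro rfl
      simp at hk
    obtain ⟨c, ⟨hcC, hc0⟩, hmin⟩ : ∃ c, (c ∈ C ∧ c ≠ 0) ∧
        ∀ x, x ∈ C → x ≠ 0 → wtOn S c ≤ wtOn S x := by
      obtain ⟨c, hc, hm⟩ := Set.exists_min_image {x | x ∈ C ∧ x ≠ 0} (wtOn S)
        (Set.toFinite _) hne
      exact ⟨c, hc, fun x h1 h2 => hm x ⟨h1, h2⟩⟩
    obtain ⟨i, hi⟩ := Function.ne_iff.mp hc0
    have hfin := finrank_hyper C i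
    have hres := ih ((wtOn S c + 1) / 2) (S.filter (fun i => c i = 0)) _
      (by omega : k ≤ Module.finrank (ZMod 2) (C ⊓ LinearMap.ker (LinearMap.proj (R := ZMod 2)
        (φ := fun _ : Fin 40 => ZMod 2) i) : Submodule (ZMod 2) (Fin 40 → ZMod 2)))
      (by
        rintro x ⟨hxC, hxi⟩ hx0
        have hxi' : x i = 0 := hxi
        have h1 := hmin x hxC hx0
        have h2 := hmin (x + c) (C.add_mem hxC hcC) (by
          intro h
          apply hi
          have := congrFun h i
          simpa [hxi'] using this)
        have h3 := wtOn_residual S x c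
        omega)
    have h5 := hd c hcC hc0
    have h6 := gries_mono k ((d + 1) / 2) ((wtOn S c + 1) / 2) (by omega)
    have h7 := card_residual S c
    simp only [gries]
    omega

/-- A binary linear code of length 40 and dimension at least 7 contains a nonzero
element of Hamming weight strictly less than 20. -/
theorem stmt_0 (C : Submodule (ZMod 2) (Fin 40 → ZMod 2))
    (h : 7 ≤ Module.finrank (ZMod 2) C) :
    ∃ x ∈ C, x ≠ 0 ∧ hammingNorm x < 20 := by
  by_contra! hcon
  have := griesmer 7 20 Finset.univ C h (by
    intro x hx hx0
    have h1 := hcon x hx hx0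
    have h2 : hammingNorm x = wtOn Finset.univ x := by
      unfold hammingNorm wtOn
      rw [Finset.card_filter]
      apply Finset.sum_congr rfl
      intro i _
      simp only [ne_eq, ite_not]
    omega)
  simp [gries] at this
end

section
/- Let C be an 𝔽₂-linear subspace of (ℤ/2ℤ)^40 of dimension 8 such that the Hamming weight of every nonzero element of C lies in the set {16, 20, 24}. Then C contains an element of Hamming weight exactly 16. -/
def chi2 (x : ZMod 2) : ℤ := if x = 0 then 1 else -1

theorem chi2_add (x y : ZMod 2) : chi2 (x + y) = chi2 x * chi2 y := by
  revert x y; decide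

theorem chi2_sum_nonneg {V : Type*} [AddCommGroup V] [Fintype V] (f : V → ZMod 2)
    (hf : ∀ a b, f (a + b) = f a + f b) : 0 ≤ ∑ c : V, chi2 (f c) := by
  by_cases h : ∃ c0, f c0 ≠ 0
  · obtain ⟨c0, h0⟩ := h
    have h1 : ∑ c : V, chi2 (f (c + c0)) = ∑ c : V, chi2 (f c) :=
      Equiv.sum_comp (Equiv.addRight c0) (fun c => chi2 (f c))
    have h2 : chi2 (f c0) = -1 := by simp [chi2, h0]
    simp only [hf, chi2_add, h2, ← Finset.sum_mul] at h1
    linarith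
  · push Not at h
    apply Finset.sum_nonneg
    intro c _
    simp [chi2, h c]

theorem chi2_weight (x : Fin 40 → ZMod 2) :
    ∑ i, chi2 (x i) = 40 - 2 * (hammingNorm x : ℤ) := by
  have h : ∀ a : ZMod 2, chi2 a = 1 - 2 * (if a ≠ 0 then 1 else 0) := by decide
  simp only [h, Finset.sum_sub_distrib, ← Finset.mul_sum, hammingNorm, Finset.sum_boole]
  simp

/-- A binary linear code of length 40 and dimension 8 all of whose nonzero weights
lie in {16, 20, 24} contains an element of weight exactly 16. -/
theorem stmt_1 (C : Submodule (ZMod 2) (Fin 40 → ZMod 2))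
    (hdim : Module.finrank (ZMod 2) C = 8)
    (hw : ∀ x ∈ C, x ≠ 0 → hammingNorm x ∈ ({16, 20, 24} : Set ℕ)) :
    ∃ x ∈ C, hammingNorm x = 16 := by
  classical
  by_contra! hno
  have : Fintype C := Fintype.ofFinite C
  have hcard : Fintype.card C = 256 := by
    rw [Module.card_eq_pow_finrank (K := ZMod 2) (V := C), hdim, ZMod.card]; norm_num
  let S : C → ℤ := fun c => ∑ i, chi2 (c.1 i)
  have hS : ∀ c : C, c ≠ 0 → S c * S c + 8 * S c = 0 := by
    intro c hc
    have h1 := hw c.1 c.2 (by simpa using hc)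
    have h2 := hno c.1 c.2
    simp only [Set.mem_insert_iff, Set.mem_singleton_iff] at h1
    simp only [S, chi2_weight]
    rcases h1 with h | h | h
    · exact absurd h h2
    · rw [h]; norm_num
    · rw [h]; norm_num
  have htot : ∑ c : C, (S c * S c + 8 * S c) = 1920 := by
    rw [Finset.sum_eq_single (0 : C) (fun c _ hc => hS c hc) (by simp)]
    simp [S, chi2]
  have hlin : 0 ≤ ∑ c : C, S c := by
    simp only [S]
    rw [Finset.sum_comm]
    exact Finset.sum_nonneg fun i _ => chi2_sum_nonneg (fun c : C => c.1 i) (by intro a b; simp)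
  have hquad : 10240 ≤ ∑ c : C, S c * S c := by
    simp only [S, Finset.sum_mul_sum, ← chi2_add]
    rw [Finset.sum_comm]
    have key : ∀ i : Fin 40, (256 : ℤ) ≤ ∑ c : C, ∑ j, chi2 (c.1 i + c.1 j) := by
      intro i
      rw [Finset.sum_comm]
      have hi : ∑ c : C, chi2 (c.1 i + c.1 i) = 256 := by
        simp [CharTwo.add_self_eq_zero, chi2, hcard]
      rw [← hi]
      exact Finset.single_le_sum (f := fun j => ∑ c : C, chi2 (c.1 i + c.1 j))
        (fun j _ => chi2_sum_nonneg (fun c : C => c.1 i + c.1 j)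
          (by intro a b; simp; ring)) (Finset.mem_univ i)
    calc (10240 : ℤ) = ∑ _i : Fin 40, (256 : ℤ) := by simp
      _ ≤ _ := Finset.sum_le_sum fun i _ => key i
  rw [Finset.sum_add_distrib, ← Finset.mul_sum] at htot
  linarith
end

section
/- Let P = ℂ[x,y,u,v,w] be the polynomial ring in five variables over ℂ. Let σ₁ be the ℂ-algebra automorphism of P determined by x ↦ x, y ↦ y, u ↦ −u, v ↦ −v, w ↦ w, and let σ₂ be the ℂ-algebra automorphism determined by x ↦ x, y ↦ y, u ↦ u, v ↦ −v, w ↦ −w. Then the subalgebra of elements of P fixed by both σ₁ and σ₂ is exactly the ℂ-subalgebra generated by x, y, u², v², w², and uvw. -/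
open MvPolynomial

theorem mono_aux (A : Subalgebra ℂ (MvPolynomial (Fin 5) ℂ))
    (h0 : X 0 ∈ A) (h1 : X 1 ∈ A) (h2 : X 2 ^ 2 ∈ A) (h3 : X 3 ^ 2 ∈ A) (h4 : X 4 ^ 2 ∈ A)
    (h5 : X 2 * X 3 * X 4 ∈ A) (c : ℂ) (a b d e f : ℕ) :
    (1 + (-1) ^ d * (-1) ^ e) * (1 + (-1) ^ e * (-1) ^ f) *
      (C c * (X 0 ^ a * X 1 ^ b * X 2 ^ d * X 3 ^ e * X 4 ^ f)) ∈ A := by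
  have hc : C c ∈ A := A.algebraMap_mem c
  have hab : C c * (X 0 ^ a * X 1 ^ b) ∈ A :=
    A.mul_mem hc (A.mul_mem (A.pow_mem h0 _) (A.pow_mem h1 _))
  have hsq : ∀ i j k : ℕ, (X 2 ^ 2) ^ i * (X 3 ^ 2) ^ j * (X 4 ^ 2) ^ k ∈ A := fun i j k =>
    A.mul_mem (A.mul_mem (A.pow_mem h2 _) (A.pow_mem h3 _)) (A.pow_mem h4 _)
  have four : (4 : MvPolynomial (Fin 5) ℂ) ∈ A := by
    simpa using A.natCast_mem 4
  rcases Nat.even_or_odd' d with ⟨i, rfl | rfl⟩ <;>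
  rcases Nat.even_or_odd' e with ⟨j, rfl | rfl⟩ <;>
  rcases Nat.even_or_odd' f with ⟨k, rfl | rfl⟩ <;>
  simp only [pow_succ, pow_mul, pow_zero, one_mul, mul_one, mul_neg, neg_neg, one_pow,
    add_neg_cancel, zero_mul, mul_zero, A.zero_mem]
  · convert A.mul_mem four (A.mul_mem hab (hsq i j k)) using 1
    ring
  · convert A.mul_mem four (A.mul_mem (A.mul_mem hab (hsq i j k)) h5) using 1
    ring

theorem avg_aux (A : Subalgebra ℂ (MvPolynomial (Fin 5) ℂ))
    (h0 : X 0 ∈ A) (h1 : X 1 ∈ A) (h2 : X 2 ^ 2 ∈ A) (h3 : X 3 ^ 2 ∈ A) (h4 : X 4 ^ 2 ∈ A)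
    (h5 : X 2 * X 3 * X 4 ∈ A)
    (σ₁ σ₂ : MvPolynomial (Fin 5) ℂ →ₐ[ℂ] MvPolynomial (Fin 5) ℂ)
    (hσ₁ : σ₁ = aeval ![X 0, X 1, -X 2, -X 3, X 4])
    (hσ₂ : σ₂ = aeval ![X 0, X 1, X 2, -X 3, -X 4]) (p : MvPolynomial (Fin 5) ℂ) :
    p + σ₁ p + σ₂ p + σ₁ (σ₂ p) ∈ A := by
  induction p using MvPolynomial.induction_on' with
  | add p q hp hq =>
    convert A.add_mem hp hq using 1
    simp only [map_add]
    ring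
  | monomial s c =>
    have hm : monomial s c =
        C c * (X 0 ^ s 0 * X 1 ^ s 1 * X 2 ^ s 2 * X 3 ^ s 3 * X 4 ^ s 4) := by
      rw [monomial_eq, Finsupp.prod_fintype _ _ (by simp), Fin.prod_univ_five]
    have hC₁ : σ₁ (C c) = C c := σ₁.commutes c
    have hC₂ : σ₂ (C c) = C c := σ₂.commutes c
    have a0 : σ₁ (X 0) = X 0 := by simp [hσ₁]
    have a1 : σ₁ (X 1) = X 1 := by simp [hσ₁]
    have a2 : σ₁ (X 2) = -X 2 := by simp [hσ₁]
    have a3 : σ₁ (X 3) = -X 3 := by simp [hσ₁]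
    have a4 : σ₁ (X 4) = X 4 := by simp [hσ₁]
    have b0 : σ₂ (X 0) = X 0 := by simp [hσ₂]
    have b1 : σ₂ (X 1) = X 1 := by simp [hσ₂]
    have b2 : σ₂ (X 2) = X 2 := by simp [hσ₂]
    have b3 : σ₂ (X 3) = -X 3 := by simp [hσ₂]
    have b4 : σ₂ (X 4) = -X 4 := by simp [hσ₂]
    convert mono_aux A h0 h1 h2 h3 h4 h5 c (s 0) (s 1) (s 2) (s 3) (s 4) using 1
    rw [hm]
    simp only [map_mul, map_pow, map_neg, hC₁, hC₂, a0, a1, a2, a3, a4, b0, b1, b2, b3, b4]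
    rw [neg_neg, neg_pow (X 2 : MvPolynomial (Fin 5) ℂ), neg_pow (X 3 : MvPolynomial (Fin 5) ℂ),
      neg_pow (X 4 : MvPolynomial (Fin 5) ℂ)]
    have := (show ((-1) ^ s 3 * (-1) ^ s 3 : MvPolynomial (Fin 5) ℂ) = 1 by rw [← mul_pow]; simp)
    linear_combination (-(-1) ^ s 2 * (-1) ^ s 4 * (C c * (X 0 ^ s 0 * X 1 ^ s 1 * X 2 ^ s 2 * X 3 ^ s 3 * X 4 ^ s 4))) * this

/-- The invariants of ℂ[x,y,u,v,w] under the group Γ ≅ (ℤ/2)² changing the signs of an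
even number of the variables u, v, w (generated by σ₁ : u ↦ -u, v ↦ -v and
σ₂ : v ↦ -v, w ↦ -w) form the subalgebra generated by x, y, u², v², w² and uvw.
Variables: x = X 0, y = X 1, u = X 2, v = X 3, w = X 4. -/
theorem stmt_2
    (σ₁ σ₂ : MvPolynomial (Fin 5) ℂ →ₐ[ℂ] MvPolynomial (Fin 5) ℂ)
    (hσ₁ : σ₁ = aeval ![X 0, X 1, -X 2, -X 3, X 4])
    (hσ₂ : σ₂ = aeval ![X 0, X 1, X 2, -X 3, -X 4]) :
    ∀ p : MvPolynomial (Fin 5) ℂ,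
      (σ₁ p = p ∧ σ₂ p = p) ↔
        p ∈ Algebra.adjoin ℂ
          ({X 0, X 1, X 2 ^ 2, X 3 ^ 2, X 4 ^ 2, X 2 * X 3 * X 4} :
            Set (MvPolynomial (Fin 5) ℂ)) := by
  intro p
  constructor
  · rintro ⟨e1, e2⟩
    have h := avg_aux (Algebra.adjoin ℂ
          ({X 0, X 1, X 2 ^ 2, X 3 ^ 2, X 4 ^ 2, X 2 * X 3 * X 4} :
            Set (MvPolynomial (Fin 5) ℂ))) (Algebra.subset_adjoin (by simp))
      (Algebra.subset_adjoin (by simp)) (Algebra.subset_adjoin (by simp))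
      (Algebra.subset_adjoin (by simp)) (Algebra.subset_adjoin (by simp))
      (Algebra.subset_adjoin (by simp)) σ₁ σ₂ hσ₁ hσ₂ p
    rw [e2, e1] at h
    have h' := Subalgebra.smul_mem _ h (1 / 4 : ℂ)
    convert h' using 1
    module
  · intro h
    have k1 : Algebra.adjoin ℂ
          ({X 0, X 1, X 2 ^ 2, X 3 ^ 2, X 4 ^ 2, X 2 * X 3 * X 4} :
            Set (MvPolynomial (Fin 5) ℂ)) ≤ AlgHom.equalizer σ₁ (AlgHom.id ℂ _) := by
      rw [Algebra.adjoin_le_iff]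
      rintro q (rfl | rfl | rfl | rfl | rfl | rfl) <;> simp [AlgHom.mem_equalizer, hσ₁]
    have k2 : Algebra.adjoin ℂ
          ({X 0, X 1, X 2 ^ 2, X 3 ^ 2, X 4 ^ 2, X 2 * X 3 * X 4} :
            Set (MvPolynomial (Fin 5) ℂ)) ≤ AlgHom.equalizer σ₂ (AlgHom.id ℂ _) := by
      rw [Algebra.adjoin_le_iff]
      rintro q (rfl | rfl | rfl | rfl | rfl | rfl) <;> simp [AlgHom.mem_equalizer, hσ₂]
    exact ⟨k1 h, k2 h⟩
end

section
/- Let i ∈ ℂ denote the imaginary unit. For all complex numbers x, y, z, t, u, v, w, set X = x + t, T = t − x, Y = y + iz, Z = y − iz, U = u, V = 2v, W = 2w. Then the four equations XT = U², YZ = U², V² = X² − Y² − Z² + T², W² = X² + Y² + Z² + T² hold simultaneously if and only if the four equations t² = x² + y² + z², u² = y² + z², v² = x² + z², w² = x² + y² hold simultaneously. -/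
/-- Under the linear change of variables X = x + t, T = t - x, Y = y + iz, Z = y - iz,
U = u, V = 2v, W = 2w, the equations XT = YZ = U², V² = X² - Y² - Z² + T²,
W² = X² + Y² + Z² + T² are equivalent to the equations of the surface of cuboids:
t² = x² + y² + z², u² = y² + z², v² = x² + z², w² = x² + y². -/
theorem stmt_5 (x y z t u v w : ℂ) :
    ((x + t) * (t - x) = u ^ 2 ∧
     (y + Complex.I * z) * (y - Complex.I * z) = u ^ 2 ∧
     (2 * v) ^ 2 =
       (x + t) ^ 2 - (y + Complex.I * z) ^ 2 - (y - Complex.I * z) ^ 2 + (t - x) ^ 2 ∧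
     (2 * w) ^ 2 =
       (x + t) ^ 2 + (y + Complex.I * z) ^ 2 + (y - Complex.I * z) ^ 2 + (t - x) ^ 2)
    ↔
    (t ^ 2 = x ^ 2 + y ^ 2 + z ^ 2 ∧
     u ^ 2 = y ^ 2 + z ^ 2 ∧
     v ^ 2 = x ^ 2 + z ^ 2 ∧
     w ^ 2 = x ^ 2 + y ^ 2) := by
  have hI : Complex.I ^ 2 = -1 := Complex.I_sq
  constructor
  · rintro ⟨h1, h2, h3, h4⟩
    have a2 : u ^ 2 = y ^ 2 + z ^ 2 := by linear_combination -h2 - z ^ 2 * hI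
    have a1 : t ^ 2 = x ^ 2 + y ^ 2 + z ^ 2 := by linear_combination h1 + a2
    refine ⟨a1, a2, ?_, ?_⟩
    · linear_combination h3 / 4 + a1 / 2 - z ^ 2 / 2 * hI
    · linear_combination h4 / 4 + a1 / 2 + z ^ 2 / 2 * hI
  · rintro ⟨a1, a2, a3, a4⟩
    refine ⟨?_, ?_, ?_, ?_⟩
    · linear_combination a1 - a2
    · linear_combination -a2 - z ^ 2 * hI
    · linear_combination 4 * a3 - 2 * a1 + 2 * z ^ 2 * hI
    · linear_combination 4 * a4 - 2 * a1 - 2 * z ^ 2 * hI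
end

section
/- Let a(x,y), b(x,y), c(x,y) be binary quadratic forms with complex coefficients such that no nonzero (x,y) ∈ ℂ² is a common zero of two of the three forms a, b, c. Let p = (x,y,u,v,w) ∈ ℂ⁵ be a nonzero vector satisfying u² = a(x,y), v² = b(x,y), w² = c(x,y). Then for any signs ε₁, ε₂, ε₃ ∈ {1, −1} with ε₁ε₂ε₃ = 1 and (ε₁, ε₂, ε₃) ≠ (1,1,1), and for any λ ∈ ℂ, one has (x, y, ε₁u, ε₂v, ε₃w) ≠ λ·(x, y, u, v, w). -/
/-- The group Γ acts freely on the curve C : u² = a(x,y), v² = b(x,y), w² = c(x,y).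
Here a, b, c are binary quadratic forms no two of which have a common nonzero zero,
(x,y,u,v,w) is a nonzero point of the affine cone over C, and (ε₁,ε₂,ε₃) is a
nontrivial triple of signs with product 1 (an element of Γ ∖ {1}); then the point
(x, y, ε₁u, ε₂v, ε₃w) is not a scalar multiple of (x, y, u, v, w). -/
theorem stmt_9 (a b c : ℂ → ℂ → ℂ) (a₀ a₁ a₂ b₀ b₁ b₂ c₀ c₁ c₂ : ℂ)
    (ha : ∀ x y, a x y = a₀ * x ^ 2 + a₁ * x * y + a₂ * y ^ 2)
    (hb : ∀ x y, b x y = b₀ * x ^ 2 + b₁ * x * y + b₂ * y ^ 2)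
    (hc : ∀ x y, c x y = c₀ * x ^ 2 + c₁ * x * y + c₂ * y ^ 2)
    (hcommon : ∀ x y : ℂ, ¬(x = 0 ∧ y = 0) →
      ¬((a x y = 0 ∧ b x y = 0) ∨ (a x y = 0 ∧ c x y = 0) ∨ (b x y = 0 ∧ c x y = 0)))
    (x y u v w : ℂ)
    (hp : ¬(x = 0 ∧ y = 0 ∧ u = 0 ∧ v = 0 ∧ w = 0))
    (hu : u ^ 2 = a x y) (hv : v ^ 2 = b x y) (hw : w ^ 2 = c x y)
    (ε₁ ε₂ ε₃ : ℂ)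
    (hε₁ : ε₁ = 1 ∨ ε₁ = -1) (hε₂ : ε₂ = 1 ∨ ε₂ = -1) (hε₃ : ε₃ = 1 ∨ ε₃ = -1)
    (hprod : ε₁ * ε₂ * ε₃ = 1) (hnontriv : ¬(ε₁ = 1 ∧ ε₂ = 1 ∧ ε₃ = 1)) :
    ∀ l : ℂ, ¬(x = l * x ∧ y = l * y ∧ ε₁ * u = l * u ∧ ε₂ * v = l * v ∧
      ε₃ * w = l * w) := by
  rintro l ⟨hx, hy, h1, h2, h3⟩
  have hxy : ¬(x = 0 ∧ y = 0) := by
    rintro ⟨rfl, rfl⟩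
    apply hp
    rw [ha] at hu
    rw [hb] at hv
    rw [hc] at hw
    refine ⟨rfl, rfl, ?_, ?_, ?_⟩
    · simpa using hu
    · simpa using hv
    · simpa using hw
  have hl : l = 1 := by
    by_contra hne
    have hne' : 1 - l ≠ 0 := fun h => hne (by linear_combination -h)
    apply hxy
    constructor
    · apply (mul_eq_zero.mp (show (1 - l) * x = 0 by linear_combination hx)).resolve_left hne'
    · apply (mul_eq_zero.mp (show (1 - l) * y = 0 by linear_combination hy)).resolve_left hne'
  subst hl
  have key : ∀ t : ℂ, -1 * t = 1 * t → t ^ 2 = 0 := by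
    intro t ht
    have : t = 0 := by linear_combination (-1 / 2) * ht
    simp [this]
  have hc' := hcommon x y hxy
  rw [← hu, ← hv, ← hw] at hc'
  rcases hε₁ with rfl | rfl <;> rcases hε₂ with rfl | rfl <;> rcases hε₃ with rfl | rfl
  · exact hnontriv ⟨rfl, rfl, rfl⟩
  · norm_num at hprod
  · norm_num at hprod
  · exact hc' (Or.inr (Or.inr ⟨key v h2, key w h3⟩))
  · norm_num at hprod
  · exact hc' (Or.inr (Or.inl ⟨key u h1, key w h3⟩))
  · exact hc' (Or.inl ⟨key u h1, key v h2⟩)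
  · norm_num at hprod
end
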